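/- Let δ > 0 and let g, h : (0,δ) → (0,+∞) be measurable functions such that g(t) ≤ g(t/2) for all t ∈ (0,δ) and h is non-increasing. Then for every N > 0, ∫₀^δ t^{N−1} g(t) h(t) dt ≥ (N / (2δ)^N) (∫₀^δ t^{N−1} g(t) dt) (∫₀^δ t^{N−1} h(t) dt). -/

import Mathlib

open MeasureTheory ENNReal

/-- Halving an interval at the origin costs at most a factor `2 ^ N` for the weight `t ^ (N - 1) * g t`
when `g t ≤ g (t / 2)`. -/
lemma lintegral_Ioo_le_lintegral_Ioo_half (δ : ℝ) (g : ℝ → ℝ)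
    (hg : ∀ t ∈ Set.Ioo 0 δ, g t ≤ g (t / 2)) (N x : ℝ) (hxδ : x ≤ δ) :
    ENNReal.ofReal ((1 / 2) ^ N) * (∫⁻ t in Set.Ioo 0 x, ENNReal.ofReal (t ^ (N - 1) * g t)) ≤
      ∫⁻ t in Set.Ioo 0 (x * (1 / 2)), ENNReal.ofReal (t ^ (N - 1) * g t) := by
  have hsub : (fun t : ℝ => t * (1 / 2)) '' Set.Ioo 0 x ⊆ Set.Ioo 0 (x * (1 / 2)) := by
    rintro _ ⟨t, ⟨h0, h1⟩, rfl⟩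
    constructor <;> linarith
  refine le_trans ?_ (lintegral_mono_set hsub)
  rw [lintegral_image_eq_lintegral_abs_deriv_mul (f' := fun _ => 1 / 2) measurableSet_Ioo
    (fun t _ => by simpa using ((hasDerivAt_id t).mul_const (1 / 2 : ℝ)).hasDerivWithinAt)
    (fun a _ b _ hab => by linarith), ← lintegral_const_mul' _ _ ofReal_ne_top]
  refine setLIntegral_mono' measurableSet_Ioo fun t ht => ?_
  have ht0 : 0 < t := ht.1
  rw [← ENNReal.ofReal_mul (by positivity), ← ENNReal.ofReal_mul (by positivity),
    abs_of_pos (by norm_num : (0 : ℝ) < 1 / 2), Real.mul_rpow ht0.le (by norm_num)]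
  have hpow : (1 / 2 : ℝ) ^ N = 1 / 2 * (1 / 2) ^ (N - 1) := by
    rw [Real.rpow_sub_one (by norm_num)]
    ring
  have hgt := hg t ⟨ht0, ht.2.trans_le hxδ⟩
  apply ENNReal.ofReal_le_ofReal
  calc (1 / 2 : ℝ) ^ N * (t ^ (N - 1) * g t)
      ≤ (1 / 2 : ℝ) ^ N * (t ^ (N - 1) * g (t / 2)) := by gcongr
    _ = 1 / 2 * (t ^ (N - 1) * (1 / 2) ^ (N - 1) * g (t * (1 / 2))) := by
      rw [hpow, show t / 2 = t * (1 / 2) by ring]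
      ring

lemma lintegral_Ioo_le_lintegral_Ioo_half_pow (δ : ℝ) (hδ : 0 < δ) (g : ℝ → ℝ)
    (hg : ∀ t ∈ Set.Ioo 0 δ, g t ≤ g (t / 2)) (N : ℝ) (n : ℕ) :
    ENNReal.ofReal (((1 / 2) ^ n) ^ N) *
        (∫⁻ t in Set.Ioo 0 δ, ENNReal.ofReal (t ^ (N - 1) * g t)) ≤
      ∫⁻ t in Set.Ioo 0 (δ * (1 / 2) ^ n), ENNReal.ofReal (t ^ (N - 1) * g t) := by
  induction n with
  | zero => simp
  | succ n ih =>
    have hle : δ * (1 / 2) ^ n ≤ δ :=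
      mul_le_of_le_one_right hδ.le (pow_le_one₀ (by norm_num) (by norm_num))
    have hstep := lintegral_Ioo_le_lintegral_Ioo_half δ g hg N _ hle
    rw [pow_succ, ← mul_assoc, Real.mul_rpow (by positivity) (by positivity), mul_comm (_ ^ N),
      ENNReal.ofReal_mul (by positivity), mul_assoc]
    exact (mul_le_mul_right ih _).trans hstep

lemma lintegral_Ioo_le_lintegral_Ioo_of_le (δ : ℝ) (hδ : 0 < δ) (g : ℝ → ℝ)
    (hg : ∀ t ∈ Set.Ioo 0 δ, g t ≤ g (t / 2)) (N : ℝ) (hN : 0 < N) (r : ℝ) (hr : 0 < r)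
    (hrδ : r ≤ δ) :
    ENNReal.ofReal ((r / (2 * δ)) ^ N) *
        (∫⁻ t in Set.Ioo 0 δ, ENNReal.ofReal (t ^ (N - 1) * g t)) ≤
      ∫⁻ t in Set.Ioo 0 r, ENNReal.ofReal (t ^ (N - 1) * g t) := by
  obtain ⟨n, hn, hn'⟩ := exists_nat_pow_near_of_lt_one (div_pos hr hδ) ((div_le_one hδ).2 hrδ)
    (by norm_num : (0 : ℝ) < 1 / 2) (by norm_num)
  have hsub : δ * (1 / 2) ^ (n + 1) ≤ r := by
    rw [lt_div_iff₀ hδ] at hn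
    linarith
  have hpow : r / (2 * δ) ≤ (1 / 2) ^ (n + 1) := by
    rw [pow_succ, show r / (2 * δ) = r / δ * (1 / 2) by field_simp]
    gcongr
  calc _ ≤ ENNReal.ofReal (((1 / 2) ^ (n + 1)) ^ N) *
        (∫⁻ t in Set.Ioo 0 δ, ENNReal.ofReal (t ^ (N - 1) * g t)) := by gcongr
    _ ≤ _ := lintegral_Ioo_le_lintegral_Ioo_half_pow δ hδ g hg N (n + 1)
    _ ≤ _ := lintegral_mono_set (Set.Ioo_subset_Ioo_right hsub)

lemma lintegral_Ioc_rpow_sub_one (N : ℝ) (hN : 0 < N) (r : ℝ) (hr : 0 ≤ r) :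
    ∫⁻ t in Set.Ioc 0 r, ENNReal.ofReal (t ^ (N - 1)) = ENNReal.ofReal (r ^ N / N) := by
  have hint : IntervalIntegrable (fun t : ℝ => t ^ (N - 1)) volume 0 r :=
    intervalIntegral.intervalIntegrable_rpow' (by linarith)
  rw [← ofReal_integral_eq_lintegral_ofReal
    ((intervalIntegrable_iff_integrableOn_Ioc_of_le hr).1 hint),
    ← intervalIntegral.integral_of_le hr, integral_rpow (Or.inl (by linarith))]
  · simp [Real.zero_rpow hN.ne']
  · filter_upwards [ae_restrict_mem measurableSet_Ioc] with t ht
    exact Real.rpow_nonneg ht.1.le _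

/-- The inequality for the indicator function of an initial segment of `(0, δ)`. -/
lemma chebyshev_type_inequality_initial_segment (δ : ℝ) (hδ : 0 < δ) (g : ℝ → ℝ)
    (hg : ∀ t ∈ Set.Ioo 0 δ, g t ≤ g (t / 2)) (N : ℝ) (hN : 0 < N)
    (A : Set ℝ) (hA : A ⊆ Set.Ioo 0 δ) (hlow : ∀ t ∈ A, ∀ s, 0 < s → s ≤ t → s ∈ A) :
    ENNReal.ofReal (N / (2 * δ) ^ N) *
        (∫⁻ t in Set.Ioo 0 δ, ENNReal.ofReal (t ^ (N - 1) * g t)) *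
        (∫⁻ t in A, ENNReal.ofReal (t ^ (N - 1))) ≤
      ∫⁻ t in A, ENNReal.ofReal (t ^ (N - 1) * g t) := by
  rcases A.eq_empty_or_nonempty with rfl | hne
  · simp
  have hbdd : BddAbove A := ⟨δ, fun t ht => (hA ht).2.le⟩
  set r := sSup A
  have hr : 0 < r := by
    obtain ⟨t, ht⟩ := hne
    exact (hA ht).1.trans_le (le_csSup hbdd ht)
  have hrδ : r ≤ δ := csSup_le hne fun t ht => (hA ht).2.le
  have hAr : A ⊆ Set.Ioc 0 r := fun t ht => ⟨(hA ht).1, le_csSup hbdd ht⟩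
  have hrA : Set.Ioo 0 r ⊆ A := fun s hs => by
    obtain ⟨t, ht, hst⟩ := exists_lt_of_lt_csSup hne hs.2
    exact hlow t ht s hs.1 hst.le
  calc _ ≤ ENNReal.ofReal (N / (2 * δ) ^ N) *
        (∫⁻ t in Set.Ioo 0 δ, ENNReal.ofReal (t ^ (N - 1) * g t)) *
        (∫⁻ t in Set.Ioc 0 r, ENNReal.ofReal (t ^ (N - 1))) := by
        gcongr
    _ = ENNReal.ofReal ((r / (2 * δ)) ^ N) *
        (∫⁻ t in Set.Ioo 0 δ, ENNReal.ofReal (t ^ (N - 1) * g t)) := by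
        rw [lintegral_Ioc_rpow_sub_one N hN r hr.le, mul_right_comm,
          ← ENNReal.ofReal_mul (by positivity), Real.div_rpow hr.le (by positivity)]
        congr 2
        field_simp
    _ ≤ _ := lintegral_Ioo_le_lintegral_Ioo_of_le δ hδ g hg N hN r hr hrδ
    _ ≤ _ := lintegral_mono_set hrA

/-- Layer-cake formula with respect to a weight `w` on a measurable set. -/
lemma setLIntegral_ofReal_mul_eq_lintegral_setLIntegral_lt {S : Set ℝ} (hS : MeasurableSet S)
    {w h : ℝ → ℝ} (hw : Measurable w) (hh : Measurable h) (hw0 : ∀ t ∈ S, 0 ≤ w t)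
    (hh0 : ∀ t ∈ S, 0 ≤ h t) :
    ∫⁻ t in S, ENNReal.ofReal (w t * h t) =
      ∫⁻ s in Set.Ioi (0 : ℝ), ∫⁻ t in {t | s < h t} ∩ S, ENNReal.ofReal (w t) := by
  have hlt (s : ℝ) : MeasurableSet {t | s < h t} := measurableSet_lt measurable_const hh
  have hcake := lintegral_eq_lintegral_meas_lt
    ((volume.restrict S).withDensity fun t => ENNReal.ofReal (w t)) (f := h)
    ((withDensity_absolutelyContinuous _ _).ae_le
      ((ae_restrict_mem hS).mono fun t ht => hh0 t ht)) hh.aemeasurable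
  rw [lintegral_withDensity_eq_lintegral_mul _ hw.ennreal_ofReal hh.ennreal_ofReal] at hcake
  simp only [withDensity_apply _ (hlt _), Measure.restrict_restrict (hlt _)] at hcake
  rw [← hcake]
  refine setLIntegral_congr_fun hS fun t ht => ?_
  simp [ENNReal.ofReal_mul (hw0 t ht)]

/-- If `g(t) ≤ g(t/2)` on `(0,δ)` and `h` is non-increasing on `(0,δ)`,
both positive and measurable, then for every `N > 0`,
`∫₀^δ t^{N-1} g(t) h(t) dt ≥ N/(2δ)^N (∫₀^δ t^{N-1} g) (∫₀^δ t^{N-1} h)`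
(as Lebesgue integrals, with values in `[0,∞]`). -/
theorem chebyshev_type_inequality
    (δ : ℝ) (hδ : 0 < δ) (g h : ℝ → ℝ)
    (hgm : Measurable g) (hhm : Measurable h)
    (hgpos : ∀ t ∈ Set.Ioo 0 δ, 0 < g t) (hhpos : ∀ t ∈ Set.Ioo 0 δ, 0 < h t)
    (hg : ∀ t ∈ Set.Ioo 0 δ, g t ≤ g (t / 2))
    (hh : AntitoneOn h (Set.Ioo 0 δ))
    (N : ℝ) (hN : 0 < N) :
    ENNReal.ofReal (N / (2 * δ) ^ N) *
        (∫⁻ t in Set.Ioo 0 δ, ENNReal.ofReal (t ^ (N - 1) * g t)) *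
        (∫⁻ t in Set.Ioo 0 δ, ENNReal.ofReal (t ^ (N - 1) * h t)) ≤
      ∫⁻ t in Set.Ioo 0 δ, ENNReal.ofReal (t ^ (N - 1) * g t * h t) := by
  have hwm : Measurable fun t : ℝ => t ^ (N - 1) := measurable_id.pow_const _
  have hw0 (t : ℝ) (ht : t ∈ Set.Ioo 0 δ) : 0 ≤ t ^ (N - 1) := Real.rpow_nonneg ht.1.le _
  have hh0 (t : ℝ) (ht : t ∈ Set.Ioo 0 δ) : 0 ≤ h t := (hhpos t ht).le
  rw [setLIntegral_ofReal_mul_eq_lintegral_setLIntegral_lt measurableSet_Ioo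
      (w := fun t => t ^ (N - 1) * g t) (hwm.mul hgm) hhm
      (fun t ht => mul_nonneg (hw0 t ht) (hgpos t ht).le) hh0,
    setLIntegral_ofReal_mul_eq_lintegral_setLIntegral_lt measurableSet_Ioo hwm hhm hw0 hh0]
  refine (lintegral_const_mul_le _ _).trans (lintegral_mono fun s => ?_)
  refine chebyshev_type_inequality_initial_segment δ hδ g hg N hN _ Set.inter_subset_right ?_
  rintro t ⟨hst, ht⟩ u hu hut
  have hu' : u ∈ Set.Ioo 0 δ := ⟨hu, hut.trans_lt ht.2⟩
  exact ⟨lt_of_lt_of_le hst (hh hu' ht hut), hu'⟩
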